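/- Let A be a 1-perfect finite-dimensional unital associative algebra over an algebraically closed field F of characteristic p with p ≠ 2 and p ≠ 3, let A' be a subalgebra of A, and let B' be a bar-minimal Jordan-Lie inner ideal of the Lie algebra A'^(-) (bar-minimality taken with respect to the image in A'/rad A'). Then there exists a bar-minimal Jordan-Lie inner ideal B of the Lie algebra A^(-) such that B' ⊆ B. -/

import Mathlib

namespace Paper

variable (F A : Type*) [Field F] [Ring A] [Algebra F A]

/-- The derived series `A⁽ᵏ⁾` of the Lie algebra `A⁽⁻⁾` (as subspaces of `A`). -/
def derivedSeries : ℕ → Submodule F A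
  | 0 => ⊤
  | (k+1) => Submodule.span F
      {z : A | ∃ x ∈ derivedSeries k, ∃ y ∈ derivedSeries k, z = ⁅x, y⁆}

variable {F A}

/-- `B` is an inner ideal of the Lie algebra given by the subspace `L` of `A⁽⁻⁾`. -/
def IsInnerIdeal (L B : Submodule F A) : Prop :=
  B ≤ L ∧ ∀ b ∈ B, ∀ b' ∈ B, ∀ x ∈ L, ⁅b, ⁅b', x⁆⁆ ∈ B

/-- `B` is a Jordan-Lie inner ideal of `L`. -/
def IsJordanLie (L B : Submodule F A) : Prop :=
  IsInnerIdeal L B ∧ ∀ b ∈ B, ∀ b' ∈ B, b * b' = 0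

/-- Jacobson radical of `A` as an `F`-subspace. -/
noncomputable def radical : Submodule F A :=
  (Ideal.jacobson (⊥ : Ideal A)).restrictScalars F

/-- The Jacobson radical of a subalgebra `A'`, as a subset of `A`. -/
def subalgRad (A' : Subalgebra F A) : Set A :=
  Subtype.val '' ((Ideal.jacobson (⊥ : Ideal A')) : Set A')

/-- `c` represents a central idempotent of the quotient of the
(sub)algebra with carrier `S` by the ideal with carrier `ρ`. -/
def IsCentralIdempotentMod (S ρ : Set A) (c : A) : Prop :=
  c ∈ S ∧ (∀ a ∈ S, c * a - a * c ∈ ρ) ∧ c * c - c ∈ ρ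

/-- `c` represents a primitive central idempotent of the quotient mod `ρ`. -/
def IsPrimitiveCentralIdempotentMod (S ρ : Set A) (c : A) : Prop :=
  IsCentralIdempotentMod S ρ c ∧ c ∉ ρ ∧
    ¬ ∃ c₁ c₂ : A, IsCentralIdempotentMod S ρ c₁ ∧ IsCentralIdempotentMod S ρ c₂ ∧
      c₁ ∉ ρ ∧ c₂ ∉ ρ ∧ c₁ * c₂ ∈ ρ ∧ c₂ * c₁ ∈ ρ ∧ c - (c₁ + c₂) ∈ ρ

/-- The idempotent pair `(e, f)` is strict w.r.t. the quotient mod `ρ`: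
for every primitive central idempotent `c` of the quotient, `c·ē = 0 ↔ c·f̄ = 0`. -/
def IsStrictPairMod (S ρ : Set A) (e f : A) : Prop :=
  ∀ c : A, IsPrimitiveCentralIdempotentMod S ρ c → (c * e ∈ ρ ↔ c * f ∈ ρ)

/-- `(e,f)` is a strict idempotent pair of `A` (strictness w.r.t. `A/rad A`). -/
def IsStrictPair (e f : A) : Prop :=
  e * e = e ∧ f * f = f ∧
    IsStrictPairMod Set.univ ((Ideal.jacobson (⊥ : Ideal A)) : Set A) e f

/-- `J` is a two-sided ideal of the (possibly non-unital) algebra `P`. -/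
def IsTwoSidedIdealIn (P J : Submodule F A) : Prop :=
  J ≤ P ∧ ∀ p ∈ P, ∀ x ∈ J, p * x ∈ J ∧ x * p ∈ J

/-- The algebra with carrier `P` is 1-perfect: it has no two-sided ideals of
codimension 1. -/
def IsOnePerfect (P : Submodule F A) : Prop :=
  ¬ ∃ J : Submodule F A, IsTwoSidedIdealIn P J ∧
      Module.finrank F P = Module.finrank F J + 1


section InnerIdeals

open MulOpposite

variable {Q : Type*} [Ring Q] [Algebra F Q]

/-- `B` is an inner ideal of the special Jordan algebra `A⁽⁺⁾`. -/
def IsJordanInner (B : Submodule F A) : Prop :=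
  ∀ b ∈ B, ∀ x : A, b * x * b ∈ B

theorem IsJordanInner.triple {B : Submodule F A} (hB : IsJordanInner B) {b c : A}
    (hb : b ∈ B) (hc : c ∈ B) (x : A) : b * x * c + c * x * b ∈ B := by
  have h := B.sub_mem (B.sub_mem (hB _ (B.add_mem hb hc) x) (hB b hb x)) (hB c hc x)
  convert h using 1
  noncomm_ring

theorem IsJordanInner.op {B : Submodule F A} (hB : IsJordanInner B) :
    IsJordanInner (B.comap (opLinearEquiv F (M := A)).symm.toLinearMap) := by
  intro b hb x
  have := hB b.unop hb x.unop
  rw [mul_assoc] at this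
  exact this

theorem exists_regular_lift (π : A →ₐ[F] Q) (hnil : ∀ r, π r = 0 → IsNilpotent r)
    {B : Submodule F A} (hB : IsJordanInner B) {b : A} (y : A) (hb : b ∈ B)
    (hby : π (b * y * b) = π b) : ∃ b' ∈ B, b' * y * b' = b' ∧ π b' = π b := by
  have key : ∀ n : ℕ, ∀ b ∈ B, π (b * y * b) = π b →
      ((b * y) * (b * y) - b * y) ^ (2 ^ n) = 0 → ∃ b' ∈ B, b' * y * b' = b' ∧ π b' = π b := by
    intro n
    induction n with
    | zero =>
      intro b hb hby h
      rw [pow_zero, pow_one, sub_eq_zero] at h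
      refine ⟨b * y * b, hB b hb y, ?_, hby⟩
      calc b * y * b * y * (b * y * b) = (b * y) * (b * y) * (b * y) * b := by noncomm_ring
        _ = _ := by rw [h, h]
    | succ n ih =>
      intro b hb hby h
      have hby' : π b * π y * π b = π b := by simpa using hby
      have hπ : π (3 • (b * y * b) - 2 • (b * (y * b * y) * b)) = π b := by
        have : π b * (π y * π b * π y) * π b = π b := by
          rw [← mul_assoc, ← mul_assoc, hby', hby']
        simp only [map_sub, map_nsmul, map_mul, hby', this]
        abel
      obtain ⟨b', hb', h1, h2⟩ := ih (3 • (b * y * b) - 2 • (b * (y * b * y) * b))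
        (B.sub_mem (B.nsmul_mem (hB b hb y) 3) (B.nsmul_mem (hB b hb _) 2))
        (by rw [map_mul, map_mul, hπ, hby']) (by
          have e : (3 • (b * y * b) - 2 • (b * (y * b * y) * b)) * y
              = 3 • (b * y) ^ 2 - 2 • (b * y) ^ 3 := by noncomm_ring
          rw [e]
          generalize b * y = g at h
          have e2 : (3 • g ^ 2 - 2 • g ^ 3) * (3 • g ^ 2 - 2 • g ^ 3) - (3 • g ^ 2 - 2 • g ^ 3)
              = (g * g - g) ^ 2 * (4 • g ^ 2 - 4 • g - 3) := by noncomm_ring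
          have hc : Commute ((g * g - g) ^ 2) (4 • g ^ 2 - 4 • g - 3) := by
            change _ = _
            noncomm_ring
          rw [e2, hc.mul_pow, ← pow_mul, ← pow_succ', h, zero_mul])
      exact ⟨b', hb', h1, h2.trans hπ⟩
  have h0 : π ((b * y) * (b * y) - b * y) = 0 := by
    rw [← mul_assoc, map_sub, map_mul π (b * y * b), hby, map_mul, sub_self]
  obtain ⟨n, hn⟩ := hnil _ h0
  exact key n b hb hby (pow_eq_zero_of_le Nat.lt_two_pow_self.le hn)

theorem exists_regular_pair (π : A →ₐ[F] Q) (hπ : Function.Surjective π)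
    (hnil : ∀ r, π r = 0 → IsNilpotent r) (hvn : ∀ q : Q, ∃ u, q * u * q = q)
    {B : Submodule F A} (hB : IsJordanInner B) {b : A} (hb : b ∈ B) :
    ∃ b' ∈ B, ∃ y, b' * y * b' = b' ∧ y * b' * y = y ∧ π b' = π b := by
  obtain ⟨u, hu⟩ := hvn (π b)
  obtain ⟨u, rfl⟩ := hπ u
  obtain ⟨b', hb', h1, h2⟩ := exists_regular_lift π hnil hB u hb (by simpa using hu)
  refine ⟨b', hb', u * b' * u, ?_, ?_, h2⟩
  · calc _ = b' * u * b' * u * b' := by noncomm_ring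
      _ = _ := by rw [h1, h1]
  · calc _ = u * (b' * u * b' * u * b') * u := by noncomm_ring
      _ = _ := by rw [h1, h1]

/-- Modulo the kernel, left multiplication by `e = b y` maps `B` into `B ∩ eA`. -/
theorem exists_row_lift (π : A →ₐ[F] Q) (hπ : Function.Surjective π)
    (hvn : ∀ q : Q, ∃ u, q * u * q = q)
    {B : Submodule F A} (hB : IsJordanInner B) {b y c : A} (hb : b ∈ B) (hc : c ∈ B)
    (hby : b * y * b = b) (hyb : y * b * y = y) :
    ∃ d ∈ B, b * y * d = d ∧ π d = π (b * y * c) := by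
  have h1 : b * (y * b) = b := by rw [← mul_assoc, hby]
  have h2 : y * (b * y) = y := by rw [← mul_assoc, hyb]
  have h1' : ∀ z, b * (y * (b * z)) = b * z := fun z => by rw [← mul_assoc, ← mul_assoc, hby]
  have h2' : ∀ z, y * (b * (y * z)) = y * z := fun z => by rw [← mul_assoc, ← mul_assoc, hyb]
  set r : A := b * y * c - b * y * c * y * b with hr
  set s : A := c * y * b - b * y * c * y * b with hs
  obtain ⟨u, hu⟩ := hvn (π r)
  obtain ⟨u, rfl⟩ := hπ u
  have hcorner : b * (y * c * y) * b ∈ B := hB b hb _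
  have hrs : r + s ∈ B := by
    convert B.sub_mem (hB.triple hb hc y) (B.nsmul_mem hcorner 2) using 1
    rw [hr, hs]
    noncomm_ring
  have hsr : s * y * r ∈ B := by
    convert hB _ hrs y using 1
    rw [hr, hs]
    simp only [mul_sub, sub_mul, mul_add, add_mul, mul_assoc, h2, h2']
    abel
  have hsh : s * y * (r * u * (b * y)) * b ∈ B := by
    convert hB.triple hb hsr ((1 - y * b) * u * (b * y)) using 1
    rw [hr, hs]
    simp only [mul_sub, sub_mul, mul_assoc, h1, h2, h1', h2', one_mul]
    abel
  have hhr : r * u * r ∈ B := by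
    convert B.sub_mem (hB.triple hb hrs (y * (r * u * (b * y)))) hsh using 1
    rw [hr, hs]
    simp only [mul_sub, sub_mul, mul_add, add_mul, mul_assoc, h1, h2, h2']
    abel
  refine ⟨r * u * r + b * (y * c * y) * b, B.add_mem hhr hcorner, ?_, ?_⟩
  · rw [hr]
    simp only [mul_sub, sub_mul, mul_add, mul_assoc, h1']
  · rw [map_add, map_mul, map_mul, hu, ← map_add, hr]
    congr 1
    noncomm_ring

/-- Products through the corner: `(B ∩ Af) A (B ∩ eA) ⊆ B`. -/
theorem IsJordanInner.mul_mem {B : Submodule F A} (hB : IsJordanInner B) {b y c d : A}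
    (hb : b ∈ B) (hc : c ∈ B) (hd : d ∈ B) (hdf : d * y * b = d) (hec : b * y * c = c) (a : A) :
    d * a * c ∈ B := by
  have h := B.sub_mem (hB.triple hd hc (y * b * a * (b * y)))
    (hB b hb (y * c * y * b * a * b * y * d * y))
  convert h using 1
  have e1 : d * (y * b * a * (b * y)) * c = (d * y * b) * a * (b * y * c) := by noncomm_ring
  have e2 : b * (y * c * y * b * a * b * y * d * y) * b
      = (b * y * c) * y * b * a * b * y * (d * y * b) := by noncomm_ring
  rw [e1, e2, hdf, hec]
  noncomm_ring

theorem exists_row_mul_lift (π : A →ₐ[F] Q) (hπ : Function.Surjective π)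
    (hvn : ∀ q : Q, ∃ u, q * u * q = q)
    {B : Submodule F A} (hB : IsJordanInner B) {b y c : A} (hb : b ∈ B) (hc : c ∈ B)
    (hby : b * y * b = b) (hyb : y * b * y = y) (x : A) :
    ∃ d ∈ B, b * y * d = d ∧ π d = π (b * x * c) := by
  have h1 : b * (y * b) = b := by rw [← mul_assoc, hby]
  have h2 : y * (b * y) = y := by rw [← mul_assoc, hyb]
  have h1' : ∀ z, b * (y * (b * z)) = b * z := fun z => by rw [← mul_assoc, ← mul_assoc, hby]
  obtain ⟨c₁, hc₁, he₁, hp₁⟩ := exists_row_lift π hπ hvn hB hb hc hby hyb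
  obtain ⟨c₂, hc₂, he₂, hp₂⟩ := exists_row_lift π hπ hvn hB hb hc
    (y := y + y * b * x * (1 - b * y))
    (by simp only [mul_sub, sub_mul, mul_add, add_mul, mul_assoc, h1, h1', mul_one]; abel)
    (by simp only [mul_sub, sub_mul, mul_add, add_mul, mul_assoc, h1, h2, h1', mul_one]; abel)
  refine ⟨c₂ - c₁ + b * x * c₁, B.add_mem (B.sub_mem hc₂ hc₁)
    (hB.mul_mem hb hc₁ hb hby he₁ x), ?_, ?_⟩
  · have : b * y * c₂ = c₂ := by
      rw [← he₂]
      simp only [mul_sub, sub_mul, mul_add, add_mul, mul_assoc, h1']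
    rw [mul_add, mul_sub, this, he₁]
    simp only [mul_assoc, h1']
  · have e : b * x * c = b * (y + y * b * x * (1 - b * y)) * c - b * y * c
        + b * x * (b * y * c) := by
      simp only [mul_sub, sub_mul, mul_add, add_mul, mul_assoc, h1', mul_one]
      abel
    rw [e]
    simp only [map_add, map_sub, map_mul _ (b * x), hp₁, hp₂]

theorem exists_col_mul_lift (π : A →ₐ[F] Q) (hπ : Function.Surjective π)
    (hvn : ∀ q : Q, ∃ u, q * u * q = q)
    {B : Submodule F A} (hB : IsJordanInner B) {b y c : A} (hb : b ∈ B) (hc : c ∈ B)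
    (hby : b * y * b = b) (hyb : y * b * y = y) (x : A) :
    ∃ d ∈ B, d * y * b = d ∧ π d = π (c * x * b) := by
  obtain ⟨d, hd, h1, h2⟩ := exists_row_mul_lift (AlgHom.op π)
    (fun q => by
      obtain ⟨a, ha⟩ := hπ q.unop
      exact ⟨op a, unop_injective ha⟩)
    (fun q => by
      obtain ⟨u, hu⟩ := hvn q.unop
      exact ⟨op u, unop_injective (by simpa [mul_assoc] using hu)⟩)
    hB.op (b := op b) (y := op y) (c := op c) hb hc
    (unop_injective (by simpa [mul_assoc] using hby))
    (unop_injective (by simpa [mul_assoc] using hyb)) (op x)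
  refine ⟨d.unop, hd, ?_, ?_⟩
  · simpa [mul_assoc] using congrArg unop h1
  · simpa [mul_assoc] using congrArg unop h2

/-- The `F`-span of the products `s q t`, a two-sided ideal. -/
def idealSpan (F : Type*) {Q : Type*} [Field F] [Ring Q] [Algebra F Q] (q : Q) : Submodule F Q :=
  Submodule.span F {z | ∃ s t, z = s * q * t}

theorem self_mem_idealSpan (q : Q) : q ∈ idealSpan F q :=
  Submodule.subset_span ⟨1, 1, by simp⟩

theorem mul_mul_mem_idealSpan {q w : Q} (hw : w ∈ idealSpan F q) (u v : Q) :
    u * w * v ∈ idealSpan F q := by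
  induction hw using Submodule.span_induction with
  | mem x hx =>
    obtain ⟨s, t, rfl⟩ := hx
    exact Submodule.subset_span ⟨u * s, t * v, by simp only [mul_assoc]⟩
  | zero => simp
  | add x y _ _ hx hy =>
    rw [mul_add, add_mul]
    exact Submodule.add_mem _ hx hy
  | smul a x _ hx =>
    rw [mul_smul_comm, smul_mul_assoc]
    exact Submodule.smul_mem _ a hx

theorem exists_generating_pair [FiniteDimensional F Q] (π : A →ₐ[F] Q)
    (hπ : Function.Surjective π) (hnil : ∀ r, π r = 0 → IsNilpotent r)
    (hvn : ∀ q : Q, ∃ u, q * u * q = q) {B : Submodule F A} (hB : IsJordanInner B) :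
    ∃ b ∈ B, ∃ y, b * y * b = b ∧ y * b * y = y ∧ ∀ c ∈ B, π c ∈ idealSpan F (π b) := by
  obtain ⟨J, ⟨b₀, hb₀, rfl⟩, hmax⟩ := (wellFounded_gt (α := Submodule F Q)).has_min
    {J | ∃ b ∈ B, J = idealSpan F (π b)} ⟨_, 0, B.zero_mem, rfl⟩
  obtain ⟨b, hb, y, hby, hyb, hπb⟩ := exists_regular_pair π hπ hnil hvn hB hb₀
  rw [← hπb] at hmax
  refine ⟨b, hb, y, hby, hyb, fun c hc => ?_⟩
  have h1' : ∀ z, b * (y * (b * z)) = b * z := fun z => by rw [← mul_assoc, ← mul_assoc, hby]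
  have hcorner : b * (y * c * y) * b ∈ B := hB b hb _
  set c₀ := c - (b * y * c + c * y * b) + b * (y * c * y) * b with hc₀
  have hc₀B : c₀ ∈ B := B.add_mem (B.sub_mem hc (hB.triple hb hc y)) hcorner
  have hmem : ∀ u v, π (u * b * v) ∈ idealSpan F (π b) := fun u v => by
    rw [map_mul, map_mul]
    exact mul_mul_mem_idealSpan (self_mem_idealSpan _) _ _
  have he : b * y * (b + c₀) = b := by
    rw [hc₀]
    simp only [mul_sub, mul_add, mul_assoc, h1']
    rw [← mul_assoc b y b, hby]
    abel
  have hle : idealSpan F (π b) ≤ idealSpan F (π (b + c₀)) := by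
    refine Submodule.span_le.2 ?_
    rintro _ ⟨s, t, rfl⟩
    refine Submodule.subset_span ⟨s * π (b * y), t, ?_⟩
    rw [mul_assoc s (π (b * y)), ← map_mul, he]
  have heq : idealSpan F (π b) = idealSpan F (π (b + c₀)) :=
    hle.eq_of_not_lt fun hlt => hmax _ ⟨_, B.add_mem hb hc₀B, rfl⟩ hlt
  have hsum : π (b + c₀) ∈ idealSpan F (π b) := heq ▸ self_mem_idealSpan _
  have e : π c = π (b + c₀) - π (1 * b * 1) + (π (1 * b * (y * c)) + π (c * y * b * 1))
      - π (1 * b * (y * c * y * b)) := by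
    simp only [← map_sub, ← map_add, hc₀]
    congr 1
    noncomm_ring
  rw [e]
  exact Submodule.sub_mem _ (Submodule.add_mem _ (Submodule.sub_mem _ hsum (hmem _ _))
    (Submodule.add_mem _ (hmem _ _) (hmem _ _))) (hmem _ _)

theorem map_mem_span_col_mul_row (π : A →ₐ[F] Q) (hπ : Function.Surjective π)
    (hvn : ∀ q : Q, ∃ u, q * u * q = q)
    {B : Submodule F A} (hB : IsJordanInner B) {b y : A} (hb : b ∈ B)
    (hby : b * y * b = b) (hyb : y * b * y = y) {c : A} (hc : c ∈ B)
    (hcb : π c ∈ idealSpan F (π b)) :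
    π c ∈ Submodule.span F {z | ∃ d ∈ B, ∃ c' ∈ B,
      d * y * b = d ∧ b * y * c' = c' ∧ z = π (d * y * c')} := by
  obtain ⟨u, hu⟩ := hvn (π c)
  have hw : ∀ w ∈ idealSpan F (π b), π c * w * π c ∈ Submodule.span F {z | ∃ d ∈ B, ∃ c' ∈ B,
      d * y * b = d ∧ b * y * c' = c' ∧ z = π (d * y * c')} := by
    intro w hw
    induction hw using Submodule.span_induction with
    | mem x hx =>
      obtain ⟨s, t, rfl⟩ := hx
      obtain ⟨s, rfl⟩ := hπ s
      obtain ⟨t, rfl⟩ := hπ t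
      obtain ⟨d, hd, hdf, hd'⟩ := exists_col_mul_lift π hπ hvn hB hb hc hby hyb s
      obtain ⟨c', hc', hec, hc''⟩ := exists_row_mul_lift π hπ hvn hB hb hc hby hyb t
      refine Submodule.subset_span ⟨d, hd, c', hc', hdf, hec, ?_⟩
      rw [map_mul, map_mul, hd', hc'']
      simp only [← map_mul]
      congr 1
      calc _ = c * s * b * t * c := by noncomm_ring
        _ = c * s * (b * y * b) * t * c := by rw [hby]
        _ = _ := by noncomm_ring
    | zero => simp
    | add x y _ _ hx hy =>
      rw [mul_add, add_mul]
      exact Submodule.add_mem _ hx hy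
    | smul a x _ hx =>
      rw [mul_smul_comm, smul_mul_assoc]
      exact Submodule.smul_mem _ a hx
  have := hw _ (mul_mul_mem_idealSpan hcb u u)
  rwa [show π c * (u * π c * u) * π c = π c * u * π c * u * π c by noncomm_ring, hu, hu] at this

theorem exists_idempotent_of_left [IsSemisimpleRing Q] (π : A →ₐ[F] Q)
    (hπ : Function.Surjective π) (hnil : ∀ r, π r = 0 → IsNilpotent r)
    (I : Submodule F A) (hI : ∀ a, ∀ x ∈ I, a * x ∈ I) :
    ∃ e ∈ I, e * e = e ∧ ∀ x ∈ I, π (x * e) = π x := by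
  let J : Submodule Q Q :=
    { carrier := π '' I
      add_mem' := by
        rintro _ _ ⟨a, ha, rfl⟩ ⟨b, hb, rfl⟩
        exact ⟨a + b, I.add_mem ha hb, map_add _ _ _⟩
      zero_mem' := ⟨0, I.zero_mem, map_zero _⟩
      smul_mem' := by
        rintro q _ ⟨a, ha, rfl⟩
        obtain ⟨q, rfl⟩ := hπ q
        exact ⟨q * a, hI q a ha, map_mul _ _ _⟩ }
  obtain ⟨W, hW⟩ := exists_isCompl J
  obtain ⟨_, ⟨e, he, rfl⟩, w, hw, hew⟩ := Submodule.mem_sup.1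
    (show (1 : Q) ∈ J ⊔ W by rw [hW.sup_eq_top]; trivial)
  have hx : ∀ x ∈ I, π (x * e) = π x := by
    intro x hx
    have h : π x * w = π (x - x * e) := by
      rw [map_sub, map_mul, eq_sub_of_add_eq' hew]
      noncomm_ring
    have h0 : π x * w = 0 := Submodule.disjoint_def.1 hW.disjoint _
      (h ▸ ⟨_, I.sub_mem hx (hI x e he), rfl⟩) (W.smul_mem (π x) hw)
    rw [h0, map_sub] at h
    exact (sub_eq_zero.1 h.symm).symm
  obtain ⟨e', he', h1, h2⟩ := exists_regular_lift π hnil (B := I)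
    (fun b hb x => hI (b * x) b hb) 1 he (by rw [mul_one]; exact hx e he)
  exact ⟨e', he', by rwa [mul_one] at h1, fun x hxI => by rw [map_mul, h2, ← map_mul, hx x hxI]⟩

theorem exists_idempotent_of_right [IsSemisimpleRing Q] (π : A →ₐ[F] Q)
    (hπ : Function.Surjective π) (hnil : ∀ r, π r = 0 → IsNilpotent r)
    (I : Submodule F A) (hI : ∀ a, ∀ x ∈ I, x * a ∈ I) :
    ∃ e ∈ I, e * e = e ∧ ∀ x ∈ I, π (e * x) = π x := by
  obtain ⟨e, he, h1, h2⟩ := exists_idempotent_of_left (AlgHom.op π)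
    (fun q => by
      obtain ⟨a, ha⟩ := hπ q.unop
      exact ⟨op a, unop_injective ha⟩)
    (fun r hr => by
      obtain ⟨n, hn⟩ := hnil r.unop (congrArg unop hr)
      exact ⟨n, unop_injective (by simpa using hn)⟩)
    (I.comap (opLinearEquiv F (M := A)).symm.toLinearMap)
    (fun a x hx => hI a.unop x.unop hx)
  exact ⟨e.unop, he, congrArg unop h1, fun x hx => congrArg unop (h2 (op x) hx)⟩

theorem mem_right_of_map_eq (π : A →ₐ[F] Q) (hnil : ∀ r, π r = 0 → IsNilpotent r)
    {I : Submodule F A} (hI : ∀ a, ∀ x ∈ I, x * a ∈ I) {e q : A} (he : e * e = e)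
    (hq : q ∈ I) (heq : e * q = q) (h : π q = π e) : e ∈ I := by
  have hu : IsUnit (1 - (e - q)) := (hnil (e - q) (by rw [map_sub, h, sub_self])).isUnit_one_sub
  obtain ⟨u, hu⟩ := hu
  have : q * ↑u⁻¹ = e := by
    rw [Units.mul_inv_eq_iff_eq_mul, hu, mul_sub, mul_sub, he, heq]
    noncomm_ring
  exact this ▸ hI _ _ hq

theorem mem_left_of_map_eq (π : A →ₐ[F] Q) (hnil : ∀ r, π r = 0 → IsNilpotent r)
    {I : Submodule F A} (hI : ∀ a, ∀ x ∈ I, a * x ∈ I) {e q : A} (he : e * e = e)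
    (hq : q ∈ I) (heq : q * e = q) (h : π q = π e) : e ∈ I := by
  have hu : IsUnit (1 - (e - q)) := (hnil (e - q) (by rw [map_sub, h, sub_self])).isUnit_one_sub
  obtain ⟨u, hu⟩ := hu
  have : ↑u⁻¹ * q = e := by
    rw [Units.inv_mul_eq_iff_eq_mul, hu, sub_mul, sub_mul, he, heq]
    noncomm_ring
  exact this ▸ hI _ _ hq

/-- The right ideal `eAgA`. -/
def rightSpan (F : Type*) {A : Type*} [Field F] [Ring A] [Algebra F A] (e g : A) :
    Submodule F A :=
  Submodule.span F {z | ∃ x a, z = e * x * g * a}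

/-- The left ideal `AeAg`. -/
def leftSpan (F : Type*) {A : Type*} [Field F] [Ring A] [Algebra F A] (e g : A) :
    Submodule F A :=
  Submodule.span F {z | ∃ x a, z = a * (e * x * g)}

theorem mul_mem_rightSpan {e g z : A} (hz : z ∈ rightSpan F e g) (a : A) :
    z * a ∈ rightSpan F e g := by
  have : rightSpan F e g ≤ (rightSpan F e g).comap (LinearMap.mulRight F a) := by
    refine Submodule.span_le.2 ?_
    rintro _ ⟨x, b, rfl⟩
    exact Submodule.subset_span ⟨x, b * a, mul_assoc _ _ _⟩
  exact this hz

theorem mul_mem_leftSpan {e g z : A} (hz : z ∈ leftSpan F e g) (a : A) :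
    a * z ∈ leftSpan F e g := by
  have : leftSpan F e g ≤ (leftSpan F e g).comap (LinearMap.mulLeft F a) := by
    refine Submodule.span_le.2 ?_
    rintro _ ⟨x, b, rfl⟩
    exact Submodule.subset_span ⟨x, a * b, (mul_assoc _ _ _).symm⟩
  exact this hz

theorem mul_eq_of_mem_rightSpan {e g z : A} (he : e * e = e) (hz : z ∈ rightSpan F e g) :
    e * z = z := by
  have : rightSpan F e g ≤ LinearMap.eqLocus (LinearMap.mulLeft F e) LinearMap.id := by
    refine Submodule.span_le.2 ?_
    rintro _ ⟨x, b, rfl⟩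
    change e * (e * x * g * b) = e * x * g * b
    simp only [← mul_assoc, he]
  exact this hz

theorem mul_eq_of_mem_leftSpan {e g z : A} (hg : g * g = g) (hz : z ∈ leftSpan F e g) :
    z * g = z := by
  have : leftSpan F e g ≤ LinearMap.eqLocus (LinearMap.mulRight F g) LinearMap.id := by
    refine Submodule.span_le.2 ?_
    rintro _ ⟨x, b, rfl⟩
    change b * (e * x * g) * g = b * (e * x * g)
    simp only [mul_assoc, hg]
  exact this hz

/-- Every inner ideal `B` contains a subspace `eAg` with the same image in the semisimple
quotient, where `e` and `g` are idempotents with `eA = eAgA` and `Ag = AeAg`. -/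
theorem exists_corner_of_surjective [FiniteDimensional F Q] [IsSemisimpleRing Q]
    (π : A →ₐ[F] Q) (hπ : Function.Surjective π) (hnil : ∀ r, π r = 0 → IsNilpotent r)
    {B : Submodule F A} (hB : IsJordanInner B) :
    ∃ e g : A, e * e = e ∧ g * g = g ∧ e ∈ rightSpan F e g ∧ g ∈ leftSpan F e g ∧
      (∀ x, e * x * g ∈ B) ∧ ∀ c ∈ B, ∃ x, π c = π (e * x * g) := by
  have hvn : ∀ q : Q, ∃ u, q * u * q = q := by
    intro q
    obtain ⟨W, hW⟩ := exists_isCompl (Submodule.span Q {q})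
    obtain ⟨v, hv, w, hw, hvw⟩ := Submodule.mem_sup.1
      (show (1 : Q) ∈ Submodule.span Q {q} ⊔ W by rw [hW.sup_eq_top]; trivial)
    obtain ⟨u, rfl⟩ := Submodule.mem_span_singleton.1 hv
    rw [smul_eq_mul] at hvw
    refine ⟨u, ?_⟩
    have h : q * w = (1 - q * u) • q := by
      rw [eq_sub_of_add_eq' hvw, smul_eq_mul]
      noncomm_ring
    have h0 : q * w = 0 := Submodule.disjoint_def.1 hW.disjoint _
      (h ▸ Submodule.smul_mem _ _ (Submodule.mem_span_singleton_self q)) (W.smul_mem q hw)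
    rw [h0, smul_eq_mul, sub_mul, one_mul] at h
    exact (sub_eq_zero.1 h.symm).symm
  obtain ⟨b, hb, y, hby, hyb, hgen⟩ := exists_generating_pair π hπ hnil hvn hB
  let D : Submodule F A := Submodule.span F {z | ∃ d ∈ B, d * y * b = d ∧ ∃ a, z = d * a}
  let C : Submodule F A := Submodule.span F {z | ∃ c ∈ B, b * y * c = c ∧ ∃ a, z = a * c}
  have hD : ∀ a, ∀ x ∈ D, x * a ∈ D := by
    intro a
    have : D ≤ D.comap (LinearMap.mulRight F a) := by
      refine Submodule.span_le.2 ?_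
      rintro _ ⟨d, hd, hdf, t, rfl⟩
      exact Submodule.subset_span ⟨d, hd, hdf, t * a, mul_assoc _ _ _⟩
    exact this
  have hC : ∀ a, ∀ x ∈ C, a * x ∈ C := by
    intro a
    have : C ≤ C.comap (LinearMap.mulLeft F a) := by
      refine Submodule.span_le.2 ?_
      rintro _ ⟨d, hd, hdf, t, rfl⟩
      exact Submodule.subset_span ⟨d, hd, hdf, a * t, (mul_assoc _ _ _).symm⟩
    exact this
  have hDmem : ∀ d ∈ B, d * y * b = d → d ∈ D := fun d hd h =>
    Submodule.subset_span ⟨d, hd, h, 1, (mul_one d).symm⟩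
  have hCmem : ∀ c ∈ B, b * y * c = c → c ∈ C := fun c hc h =>
    Submodule.subset_span ⟨c, hc, h, 1, (one_mul c).symm⟩
  have hDC : ∀ d ∈ D, ∀ c ∈ C, d * c ∈ B := by
    have h1 : ∀ d ∈ B, d * y * b = d → ∀ a, C ≤ B.comap (LinearMap.mulLeft F (d * a)) := by
      intro d hd hdf a
      refine Submodule.span_le.2 ?_
      rintro _ ⟨c, hc, hec, t, rfl⟩
      have := hB.mul_mem hb hc hd hdf hec (a * t)
      change d * a * (t * c) ∈ B
      convert this using 1
      noncomm_ring
    intro d hd c hc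
    have h2 : D ≤ B.comap (LinearMap.mulRight F c) := by
      refine Submodule.span_le.2 ?_
      rintro _ ⟨d, hd, hdf, t, rfl⟩
      exact h1 d hd hdf t hc
    exact h2 hd
  obtain ⟨e, heD, hee, he⟩ := exists_idempotent_of_right π hπ hnil D hD
  obtain ⟨g, hgC, hgg, hg⟩ := exists_idempotent_of_left π hπ hnil C hC
  refine ⟨e, g, hee, hgg, ?_, ?_, fun x => hDC _ (hD x e heD) g hgC, fun c hc => ?_⟩
  · have h : D ≤ ((rightSpan F e g).map π.toLinearMap).comap π.toLinearMap := by
      refine Submodule.span_le.2 ?_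
      rintro _ ⟨d, hd, hdf, a, rfl⟩
      refine ⟨e * (d * y * b) * g * a, Submodule.subset_span ⟨_, a, rfl⟩, ?_⟩
      change π _ = π _
      rw [show e * (d * y * b) * g * a = e * d * y * (b * g) * a by noncomm_ring]
      conv_rhs => rw [← hdf]
      simp only [map_mul _ _ a, map_mul _ _ (b * g), map_mul _ _ y, map_mul _ _ b,
        he d (hDmem d hd hdf), hg b (hCmem b hb hby)]
    obtain ⟨q, hq, hqe⟩ := h heD
    exact mem_right_of_map_eq π hnil (fun a x hx => mul_mem_rightSpan hx a) hee hq
      (mul_eq_of_mem_rightSpan hee hq) hqe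
  · have h : C ≤ ((leftSpan F e g).map π.toLinearMap).comap π.toLinearMap := by
      refine Submodule.span_le.2 ?_
      rintro _ ⟨c, hc, hec, a, rfl⟩
      refine ⟨a * (e * (b * y * c) * g), Submodule.subset_span ⟨_, a, rfl⟩, ?_⟩
      change π _ = π _
      rw [show a * (e * (b * y * c) * g) = a * ((e * b) * y * (c * g)) by noncomm_ring]
      conv_rhs => rw [← hec]
      simp only [map_mul _ a, map_mul _ _ (c * g), map_mul _ _ y, map_mul _ _ c,
        he b (hDmem b hb hby), hg c (hCmem c hc hec)]
    obtain ⟨q, hq, hqe⟩ := h hgC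
    exact mem_left_of_map_eq π hnil (fun a x hx => mul_mem_leftSpan hx a) hgg hq
      (mul_eq_of_mem_leftSpan hgg hq) hqe
  · have h := map_mem_span_col_mul_row π hπ hvn hB hb hby hyb hc (hgen c hc)
    have hle : Submodule.span F {z | ∃ d ∈ B, ∃ c' ∈ B,
        d * y * b = d ∧ b * y * c' = c' ∧ z = π (d * y * c')} ≤
        LinearMap.range (π.toLinearMap ∘ₗ LinearMap.mulRight F g ∘ₗ LinearMap.mulLeft F e) := by
      refine Submodule.span_le.2 ?_
      rintro _ ⟨d, hd, c', hc', hdf, hec, rfl⟩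
      refine ⟨d * y * c', ?_⟩
      change π (e * (d * y * c') * g) = _
      rw [show e * (d * y * c') * g = e * d * y * (c' * g) by noncomm_ring]
      simp only [map_mul _ _ y, map_mul _ _ (c' * g), map_mul _ _ c',
        he d (hDmem d hd hdf), hg c' (hCmem c' hc' hec)]
    obtain ⟨x, hx⟩ := hle h
    exact ⟨x, hx.symm⟩

theorem isNilpotent_of_mk_jacobson_eq_zero [IsArtinianRing A] (r : A)
    (hr : Ideal.Quotient.mkₐ F (Ring.jacobson A) r = 0) : IsNilpotent r := by
  have hr' : r ∈ Ring.jacobson A := Ideal.Quotient.eq_zero_iff_mem.1 hr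
  obtain ⟨n, hn⟩ := IsSemiprimaryRing.isNilpotent (R := A)
  refine ⟨n, ?_⟩
  have := Ideal.pow_mem_pow hr' n
  rwa [hn] at this

theorem exists_corner [FiniteDimensional F A] {B : Submodule F A} (hB : IsJordanInner B) :
    ∃ e g : A, e * e = e ∧ g * g = g ∧ e ∈ rightSpan F e g ∧ g ∈ leftSpan F e g ∧
      (∀ x, e * x * g ∈ B) ∧
      ∀ c ∈ B, ∃ x, c - e * x * g ∈ Ideal.jacobson (⊥ : Ideal A) := by
  have : IsArtinianRing A := IsArtinianRing.of_finite F A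
  have : FiniteDimensional F (A ⧸ Ring.jacobson A) :=
    Module.Finite.of_surjective (Ideal.Quotient.mkₐ F (Ring.jacobson A)).toLinearMap
      (Ideal.Quotient.mkₐ_surjective F _)
  obtain ⟨e, g, h1, h2, h3, h4, h5, h6⟩ := exists_corner_of_surjective
    (Ideal.Quotient.mkₐ F (Ring.jacobson A)) (Ideal.Quotient.mkₐ_surjective F _)
    isNilpotent_of_mk_jacobson_eq_zero hB
  refine ⟨e, g, h1, h2, h3, h4, h5, fun c hc => ?_⟩
  obtain ⟨x, hx⟩ := h6 c hc
  refine ⟨x, ?_⟩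
  rw [Ideal.jacobson_bot]
  exact Ideal.Quotient.eq.1 hx

theorem lie_lie_eq_of_mul_eq_zero {b c : A} (hbc : b * c = 0) (hcb : c * b = 0) (x : A) :
    ⁅b, ⁅c, x⁆⁆ = -(b * x * c + c * x * b) := by
  have e : ⁅b, ⁅c, x⁆⁆ = b * c * x - b * x * c - c * x * b + x * (c * b) := by
    simp only [Ring.lie_def]
    noncomm_ring
  rw [e, hbc, hcb]
  noncomm_ring

theorem mul_mul_mem_of_isInnerIdeal (h2 : (2 : F) ≠ 0) {L B : Submodule F A}
    (hB : IsInnerIdeal L B) (hsq : ∀ b ∈ B, b * b = 0) {b : A} (hb : b ∈ B) {x : A} (hx : x ∈ L) :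
    b * x * b ∈ B := by
  have h := hB.2 b hb b hb x hx
  rw [lie_lie_eq_of_mul_eq_zero (hsq b hb) (hsq b hb), neg_mem_iff, ← two_smul F] at h
  exact (B.smul_mem_iff h2).1 h

theorem mul_mul_mul_mul_eq_zero {e g u v : A} (h : ∀ x y, e * x * g * (e * y * g) = 0)
    (hu : u ∈ rightSpan F e g) (hv : v ∈ leftSpan F e g) : v * u = 0 := by
  have h1 : ∀ y a, leftSpan F e g ≤ LinearMap.ker (LinearMap.mulRight F (e * y * g * a)) := by
    intro y a
    refine Submodule.span_le.2 ?_
    rintro _ ⟨x, b, rfl⟩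
    change b * (e * x * g) * (e * y * g * a) = 0
    rw [show b * (e * x * g) * (e * y * g * a) = b * (e * x * g * (e * y * g)) * a by noncomm_ring,
      h, mul_zero, zero_mul]
  have h2 : rightSpan F e g ≤ LinearMap.ker (LinearMap.mulLeft F v) := by
    refine Submodule.span_le.2 ?_
    rintro _ ⟨y, a, rfl⟩
    exact h1 y a hv
  exact h2 hu

/-- The subspace `eAg`. -/
def corner (F : Type*) {A : Type*} [Field F] [Ring A] [Algebra F A] (e g : A) : Submodule F A :=
  LinearMap.range (LinearMap.mulRight F g ∘ₗ LinearMap.mulLeft F e)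

theorem mem_corner {e g z : A} : z ∈ corner F e g ↔ ∃ x, e * x * g = z :=
  Iff.rfl

theorem corner_mul_corner {e g z w : A} (hge : g * e = 0) (hz : z ∈ corner F e g)
    (hw : w ∈ corner F e g) : z * w = 0 := by
  obtain ⟨x, rfl⟩ := mem_corner.1 hz
  obtain ⟨y, rfl⟩ := mem_corner.1 hw
  rw [show e * x * g * (e * y * g) = e * x * (g * e) * (y * g) by noncomm_ring, hge]
  simp

theorem isJordanLie_corner {e g : A} (hge : g * e = 0) :
    IsJordanLie (⊤ : Submodule F A) (corner F e g) := by
  refine ⟨⟨le_top, fun b hb c hc x _ => ?_⟩, fun b hb c hc => corner_mul_corner hge hb hc⟩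
  rw [lie_lie_eq_of_mul_eq_zero (corner_mul_corner hge hb hc) (corner_mul_corner hge hc hb)]
  obtain ⟨u, rfl⟩ := mem_corner.1 hb
  obtain ⟨v, rfl⟩ := mem_corner.1 hc
  exact mem_corner.2 ⟨-(u * g * x * e * v + v * g * x * e * u), by noncomm_ring⟩

/-- The corner `eAg` of a pair of idempotents with `eA = eAgA` and `Ag = AeAg` is bar-minimal. -/
theorem corner_bar_minimal [FiniteDimensional F A] (h2 : (2 : F) ≠ 0) {e g : A} (hee : e * e = e)
    (hgg : g * g = g) (he : e ∈ rightSpan F e g) (hg : g ∈ leftSpan F e g) (hge : g * e = 0)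
    {B₀ : Submodule F A} (hB₀ : IsInnerIdeal (⊤ : Submodule F A) B₀) (hle : B₀ ≤ corner F e g)
    (hbar : ∀ x ∈ corner F e g, ∃ y ∈ B₀, x - y ∈ (radical : Submodule F A)) :
    B₀ = corner F e g := by
  have : IsArtinianRing A := IsArtinianRing.of_finite F A
  have hJ : IsJordanInner B₀ := fun b hb x => mul_mul_mem_of_isInnerIdeal h2 hB₀
    (fun b hb => corner_mul_corner hge (hle hb) (hle hb)) hb trivial
  obtain ⟨e₀, g₀, he₀, hg₀, he₀', hg₀', hmem, himg⟩ := exists_corner hJ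
  have hnil : ∀ r, Ideal.Quotient.mkₐ F (Ring.jacobson A) r = 0 → IsNilpotent r :=
    isNilpotent_of_mk_jacobson_eq_zero
  have happrox : ∀ x, ∃ y, Ideal.Quotient.mkₐ F (Ring.jacobson A) (e₀ * y * g₀)
      = Ideal.Quotient.mkₐ F (Ring.jacobson A) (e * x * g) := by
    intro x
    obtain ⟨b, hb, hxb⟩ := hbar _ (mem_corner.2 ⟨x, rfl⟩)
    obtain ⟨y, hy⟩ := himg b hb
    refine ⟨y, (Ideal.Quotient.eq.2 ?_).symm⟩
    rw [← Ideal.jacobson_bot]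
    simpa using Ideal.add_mem _ hxb hy
  have hee₀ : e * e₀ = e₀ := by
    have : rightSpan F e₀ g₀ ≤ LinearMap.eqLocus (LinearMap.mulLeft F e) LinearMap.id := by
      refine Submodule.span_le.2 ?_
      rintro _ ⟨x, a, rfl⟩
      obtain ⟨y, hy⟩ := mem_corner.1 (hle (hmem x))
      change e * (e₀ * x * g₀ * a) = e₀ * x * g₀ * a
      rw [← hy]
      simp only [← mul_assoc, hee]
    exact this he₀'
  have hgg₀ : g₀ * g = g₀ := by
    have : leftSpan F e₀ g₀ ≤ LinearMap.eqLocus (LinearMap.mulRight F g) LinearMap.id := by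
      refine Submodule.span_le.2 ?_
      rintro _ ⟨x, a, rfl⟩
      obtain ⟨y, hy⟩ := mem_corner.1 (hle (hmem x))
      change a * (e₀ * x * g₀) * g = a * (e₀ * x * g₀)
      rw [← hy]
      simp only [mul_assoc, hgg]
    exact this hg₀'
  have he_mem : e ∈ LinearMap.range (LinearMap.mulLeft F e₀) := by
    have h : rightSpan F e g ≤ ((LinearMap.range (LinearMap.mulLeft F e₀)).map
        (Ideal.Quotient.mkₐ F (Ring.jacobson A)).toLinearMap).comap
        (Ideal.Quotient.mkₐ F (Ring.jacobson A)).toLinearMap := by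
      refine Submodule.span_le.2 ?_
      rintro _ ⟨x, a, rfl⟩
      obtain ⟨y, hy⟩ := happrox x
      refine ⟨_, ⟨y * g₀ * a, rfl⟩, ?_⟩
      change Ideal.Quotient.mkₐ F (Ring.jacobson A) (e₀ * (y * g₀ * a))
        = Ideal.Quotient.mkₐ F (Ring.jacobson A) (e * x * g * a)
      rw [map_mul _ _ a, ← hy, ← map_mul]
      simp only [mul_assoc]
    obtain ⟨_, ⟨q, rfl⟩, hq⟩ := h he
    refine mem_right_of_map_eq _ hnil ?_ hee ⟨q, rfl⟩ ?_ hq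
    · rintro a _ ⟨z, rfl⟩
      exact ⟨z * a, (mul_assoc e₀ z a).symm⟩
    · change e * (e₀ * q) = e₀ * q
      rw [← mul_assoc, hee₀]
  have hg_mem : g ∈ LinearMap.range (LinearMap.mulRight F g₀) := by
    have h : leftSpan F e g ≤ ((LinearMap.range (LinearMap.mulRight F g₀)).map
        (Ideal.Quotient.mkₐ F (Ring.jacobson A)).toLinearMap).comap
        (Ideal.Quotient.mkₐ F (Ring.jacobson A)).toLinearMap := by
      refine Submodule.span_le.2 ?_
      rintro _ ⟨x, a, rfl⟩
      obtain ⟨y, hy⟩ := happrox x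
      refine ⟨_, ⟨a * (e₀ * y), rfl⟩, ?_⟩
      change Ideal.Quotient.mkₐ F (Ring.jacobson A) (a * (e₀ * y) * g₀)
        = Ideal.Quotient.mkₐ F (Ring.jacobson A) (a * (e * x * g))
      rw [map_mul _ a, ← hy, ← map_mul]
      simp only [mul_assoc]
    obtain ⟨_, ⟨q, rfl⟩, hq⟩ := h hg
    refine mem_left_of_map_eq _ hnil ?_ hgg ⟨q, rfl⟩ ?_ hq
    · rintro a _ ⟨z, rfl⟩
      exact ⟨a * z, mul_assoc a z g₀⟩
    · change q * g₀ * g = q * g₀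
      rw [mul_assoc, hgg₀]
  obtain ⟨s, hs⟩ := he_mem
  obtain ⟨t, ht⟩ := hg_mem
  change e₀ * s = e at hs
  change t * g₀ = g at ht
  refine le_antisymm hle fun z hz => ?_
  obtain ⟨x, rfl⟩ := mem_corner.1 hz
  rw [← hs, ← ht]
  convert hmem (s * x * t) using 1
  noncomm_ring

end InnerIdeals

/-- **Corollary (1).** With `A` 1-perfect finite-dimensional, `p ≠ 2,3`, `A'` a
subalgebra and `B'` a bar-minimal Jordan-Lie inner ideal of `A'⁽⁻⁾`, there is a
bar-minimal Jordan-Lie inner ideal `B` of `A⁽⁻⁾` with `B' ⊆ B`. -/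
theorem corollary_one (F A : Type*) [Field F] [IsAlgClosed F] (p : ℕ) [CharP F p]
    (hp2 : p ≠ 2) (hp3 : p ≠ 3) [Ring A] [Algebra F A] [FiniteDimensional F A]
    (h1perf : IsOnePerfect (⊤ : Submodule F A))
    (A' : Subalgebra F A) (B' : Submodule F A)
    (hJLie : IsJordanLie (Subalgebra.toSubmodule A') B')
    (hmin : ∀ B₀ : Submodule F A, IsInnerIdeal (Subalgebra.toSubmodule A') B₀ →
      B₀ ≤ B' →
      (∀ x ∈ B', ∃ y ∈ B₀, x - y ∈ subalgRad A') → B₀ = B') :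
    ∃ B : Submodule F A, IsJordanLie (⊤ : Submodule F A) B ∧
      (∀ B₀ : Submodule F A, IsInnerIdeal (⊤ : Submodule F A) B₀ → B₀ ≤ B →
        (∀ x ∈ B, ∃ y ∈ B₀, x - y ∈ (radical : Submodule F A)) → B₀ = B) ∧
      B' ≤ B := by
  have h2 : (2 : F) ≠ 0 := by
    intro h
    have hdvd : p ∣ 2 := (CharP.cast_eq_zero_iff F p 2).1 (by exact_mod_cast h)
    rcases (Nat.dvd_prime Nat.prime_two).1 hdvd with h1 | h1
    · exact CharP.char_ne_one F p h1
    · exact hp2 h1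
  let C : Submodule F A' := B'.comap A'.val.toLinearMap
  have hC : IsJordanInner C := fun b hb x =>
    mul_mul_mem_of_isInnerIdeal h2 hJLie.1 (fun b hb => hJLie.2 b hb b hb) hb x.2
  obtain ⟨e, g, hee, hgg, he, hg, hmem, himg⟩ := exists_corner hC
  have hge : g * e = 0 := mul_mul_mul_mul_eq_zero (F := F)
    (fun x y => Subtype.ext (hJLie.2 _ (hmem x) _ (hmem y))) he hg
  have hB' : (corner F e g).map A'.val.toLinearMap = B' := by
    refine hmin _ ⟨?_, ?_⟩ ?_ ?_
    · rintro _ ⟨x, -, rfl⟩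
      exact x.2
    · rintro _ ⟨b, hb, rfl⟩ _ ⟨c, hc, rfl⟩ x hx
      exact ⟨⁅b, ⁅c, ⟨x, hx⟩⁆⁆, (isJordanLie_corner hge).1.2 b hb c hc ⟨x, hx⟩ trivial, rfl⟩
    · rintro _ ⟨_, ⟨x, rfl⟩, rfl⟩
      exact hmem x
    · intro x hx
      obtain ⟨y, hy⟩ := himg ⟨x, hJLie.1.1 hx⟩ hx
      exact ⟨_, ⟨_, ⟨y, rfl⟩, rfl⟩, _, hy, rfl⟩
  have hge' : (g : A) * e = 0 := congrArg Subtype.val hge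
  have he' : (e : A) ∈ rightSpan F (e : A) g := by
    have h : rightSpan F e g ≤ (rightSpan F (e : A) g).comap A'.val.toLinearMap := by
      refine Submodule.span_le.2 ?_
      rintro _ ⟨x, a, rfl⟩
      exact Submodule.subset_span ⟨x, a, rfl⟩
    exact h he
  have hg' : (g : A) ∈ leftSpan F (e : A) g := by
    have h : leftSpan F e g ≤ (leftSpan F (e : A) g).comap A'.val.toLinearMap := by
      refine Submodule.span_le.2 ?_
      rintro _ ⟨x, a, rfl⟩
      exact Submodule.subset_span ⟨x, a, rfl⟩
    exact h hg
  refine ⟨corner F (e : A) g, isJordanLie_corner hge', fun B₀ hB₀ hle hbar =>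
    corner_bar_minimal h2 (congrArg Subtype.val hee) (congrArg Subtype.val hgg) he' hg' hge'
      hB₀ hle hbar, ?_⟩
  rw [← hB']
  rintro _ ⟨_, ⟨x, rfl⟩, rfl⟩
  exact ⟨x, rfl⟩

end Paper
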